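/- If 1 ≤ m ≤ n, then the number of 1-metered (m,n)-parking functions in which the last car (car m) parks in spot n equals the number of 1-metered (m−1,n)-parking functions; that is, z_n(m,n) = mpf_{m−1,n}(1), with the convention that mpf_{0,n}(1) = 1. -/

import Mathlib

/-- One step of the `t`-metered parking process on spots `1,…,n`:
given the outcome list `prev` for the cars that have already entered
(`prev[j-1] = some s` if car `j` parked in spot `s`, `none` if it failed to park),
compute the outcome list after the next car (with preference `pref`) tries to park.
When the next car enters, the occupied spots are exactly the spots of the previous
`t` cars that are still on the street (all earlier cars have already left), and the
entering car parks in the smallest unoccupied spot `≥ pref` among `1,…,n`, if any. -/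
def parkStep (n t : ℕ) (prev : List (Option ℕ)) (pref : ℕ) : List (Option ℕ) :=
  let occ : List ℕ := (prev.drop (prev.length - t)).filterMap id
  prev ++ [((List.range' pref (n + 1 - pref)).filter (fun s => decide (s ∉ occ))).head?]

/-- The outcome of the `t`-metered parking process on spots `1,…,n` for the
preference list `l` (car `i` prefers spot `l[i-1]`); the `i`-th entry is
`some s` if car `i` parks in spot `s`, and `none` if car `i` fails to park. -/
def parkOutcome (n t : ℕ) (l : List ℕ) : List (Option ℕ) :=
  l.foldl (parkStep n t) []

/-- `l` is a `t`-metered `(m,n)`-parking function: a preference list in `[n]^m`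
under which every car parks in the `t`-metered parking scheme. -/
def MeteredPF (m n t : ℕ) (l : List ℕ) : Prop :=
  l.length = m ∧ (∀ x ∈ l, x ∈ Finset.Icc 1 n) ∧
    ∀ o ∈ parkOutcome n t l, o.isSome

/-- `l` is a classical `(m,n)`-parking function: a preference list in `[n]^m` under
which every car parks when no car ever leaves (equivalently, the `t`-metered scheme
with `t = m`, under which no car leaves while cars are still arriving). -/
def ParkingFunction (m n : ℕ) (l : List ℕ) : Prop :=
  l.length = m ∧ (∀ x ∈ l, x ∈ Finset.Icc 1 n) ∧
    ∀ o ∈ parkOutcome n m l, o.isSome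

theorem parkOutcome_append_singleton (n t : ℕ) (l : List ℕ) (a : ℕ) :
    parkOutcome n t (l ++ [a]) = parkStep n t (parkOutcome n t l) a := by
  simp [parkOutcome]

theorem length_parkOutcome (n t : ℕ) (l : List ℕ) : (parkOutcome n t l).length = l.length := by
  induction l using List.reverseRecOn with
  | nil => rfl
  | append_singleton l a ih => simp [parkOutcome_append_singleton, parkStep, ih]

theorem head?_filter_range'_eq_some_iff {n a s j : ℕ} (ha : a ≤ n) :
    ((List.range' a (n + 1 - a)).filter (fun x => decide (x ∉ [s]))).head? = some j ↔
      (a = j ∧ s ≠ j) ∨ (a = s ∧ j = s + 1 ∧ j ≤ n) := by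
  obtain ⟨k, rfl⟩ := Nat.exists_eq_add_of_le ha
  rw [show a + k + 1 - a = k + 1 by omega, List.range'_succ]
  by_cases has : a = s
  · subst has
    cases k with
    | zero => simp; omega
    | succ k => simp [List.range'_succ]; omega
  · simp [has]; grind

/-- The preference lists of length `m` under which every car parks and car `m` parks in spot `j`
(the `1`-metered scheme). -/
def lastSpotSet (m n j : ℕ) : Set (List ℕ) :=
  {l | MeteredPF m n 1 l ∧ (parkOutcome n 1 l).getD (m - 1) none = some j}

theorem MeteredPF.of_append_singleton {m n t a : ℕ} {l : List ℕ}
    (h : MeteredPF (m + 1) n t (l ++ [a])) : MeteredPF m n t l ∧ a ∈ Finset.Icc 1 n := by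
  obtain ⟨hlen, hmem, hsome⟩ := h
  rw [parkOutcome_append_singleton] at hsome
  refine ⟨⟨by simpa using hlen, fun x hx => hmem x (by simp [hx]), fun o ho => ?_⟩,
    hmem a (by simp)⟩
  exact hsome o (by simp only [parkStep, List.mem_append]; exact Or.inl ho)

theorem MeteredPF.exists_eq_append_singleton {m n t : ℕ} {l : List ℕ}
    (h : MeteredPF (m + 1) n t l) : ∃ l' a, l = l' ++ [a] := by
  have hne : l ≠ [] := by rintro rfl; simpa using h.1
  exact ⟨_, _, (List.dropLast_append_getLast hne).symm⟩

theorem finite_setOf_meteredPF (m n t : ℕ) : {l | MeteredPF m n t l}.Finite := by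
  induction m with
  | zero =>
    exact (Set.finite_singleton []).subset fun l hl => List.length_eq_zero_iff.1 hl.1
  | succ m ih =>
    refine (Set.Finite.image2 (fun l a => l ++ [a]) ih (Finset.Icc 1 n).finite_toSet).subset ?_
    intro l hl
    obtain ⟨l, a, rfl⟩ := MeteredPF.exists_eq_append_singleton hl
    have := MeteredPF.of_append_singleton hl
    exact ⟨l, this.1, a, by exact_mod_cast this.2, rfl⟩

theorem MeteredPF.exists_parkOutcome_eq {m n t : ℕ} {l : List ℕ}
    (h : MeteredPF (m + 1) n t l) : ∃ P s, parkOutcome n t l = P ++ [some s] := by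
  have hne : parkOutcome n t l ≠ [] := by
    rw [← List.length_pos_iff, length_parkOutcome, h.1]; omega
  obtain ⟨s, hs⟩ := Option.isSome_iff_exists.1 (h.2.2 _ (List.getLast_mem hne))
  exact ⟨_, s, by rw [← hs, List.dropLast_append_getLast hne]⟩

theorem append_singleton_mem_lastSpotSet_iff {m n j a : ℕ} {l : List ℕ} (hj : j ∈ Finset.Icc 2 n) :
    l ++ [a] ∈ lastSpotSet (m + 2) n j ↔
      (l ∈ {l | MeteredPF (m + 1) n 1 l} \ lastSpotSet (m + 1) n j ∧ a = j) ∨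
        (l ∈ lastSpotSet (m + 1) n (j - 1) ∧ a = j - 1) := by
  rw [Finset.mem_Icc] at hj
  by_cases hl : MeteredPF (m + 1) n 1 l
  swap
  · have hl' : ¬ MeteredPF (m + 2) n 1 (l ++ [a]) := fun h => hl h.of_append_singleton.1
    simp [lastSpotSet, hl, hl']
  by_cases ha : a ∈ Finset.Icc 1 n
  swap
  · have hl' : ¬ MeteredPF (m + 2) n 1 (l ++ [a]) := fun h => ha h.of_append_singleton.2
    rw [Finset.mem_Icc] at ha
    simp only [lastSpotSet, hl', false_and, Set.mem_ofPred_eq, false_iff]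
    omega
  obtain ⟨P, s, hP⟩ := hl.exists_parkOutcome_eq
  have hlen : P.length = m := by
    have := length_parkOutcome n 1 l
    rw [hP, hl.1] at this
    simpa using this
  have hstep : parkOutcome n 1 (l ++ [a]) = P ++ [some s] ++
      [((List.range' a (n + 1 - a)).filter (fun x => decide (x ∉ [s]))).head?] := by
    simp [parkOutcome_append_singleton, parkStep, hP]
  have key := head?_filter_range'_eq_some_iff (s := s) (j := j) (Finset.mem_Icc.1 ha).2
  have hlast (i : ℕ) : l ∈ lastSpotSet (m + 1) n i ↔ s = i := by
    subst hlen
    simp [lastSpotSet, hl, hP]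
  have hnew : l ++ [a] ∈ lastSpotSet (m + 2) n j ↔
      ((List.range' a (n + 1 - a)).filter (fun x => decide (x ∉ [s]))).head? = some j := by
    simp only [lastSpotSet, Set.mem_ofPred_eq, hstep]
    rw [show m + 2 - 1 = (P ++ [some s]).length by simp [hlen],
      List.getD_append_right _ _ _ _ le_rfl]
    simp only [Nat.sub_self, List.getD_cons_zero, and_iff_right_iff_imp]
    intro h
    refine ⟨by simp [hl.1], ?_, ?_⟩
    · intro x hx
      rcases List.mem_append.1 hx with hx | hx
      · exact hl.2.1 x hx
      · rw [List.mem_singleton.1 hx]; exact ha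
    · intro o ho
      rw [hstep, h, ← hP] at ho
      rcases List.mem_append.1 ho with ho | ho
      · exact hl.2.2 o ho
      · rw [List.mem_singleton.1 ho]; rfl
  rw [hnew, key, Set.mem_sdiff, hlast, hlast, Set.mem_ofPred_eq]
  simp only [hl, true_and]
  omega

theorem ncard_lastSpotSet_add_two {m n j : ℕ} (hj : j ∈ Finset.Icc 2 n) :
    (lastSpotSet (m + 2) n j).ncard + (lastSpotSet (m + 1) n j).ncard =
      {l | MeteredPF (m + 1) n 1 l}.ncard + (lastSpotSet (m + 1) n (j - 1)).ncard := by
  have hfin := finite_setOf_meteredPF (m + 1) n 1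
  have hsub (i : ℕ) : lastSpotSet (m + 1) n i ⊆ {l | MeteredPF (m + 1) n 1 l} := fun l hl => hl.1
  have hunion : lastSpotSet (m + 2) n j =
      (· ++ [j]) '' ({l | MeteredPF (m + 1) n 1 l} \ lastSpotSet (m + 1) n j) ∪
        (· ++ [j - 1]) '' lastSpotSet (m + 1) n (j - 1) := by
    ext l
    constructor
    · intro h
      obtain ⟨l, a, rfl⟩ := h.1.exists_eq_append_singleton
      rcases (append_singleton_mem_lastSpotSet_iff hj).1 h with ⟨hl, rfl⟩ | ⟨hl, rfl⟩
      · exact Or.inl ⟨l, hl, rfl⟩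
      · exact Or.inr ⟨l, hl, rfl⟩
    · rintro (⟨l, h, rfl⟩ | ⟨l, h, rfl⟩)
      · exact (append_singleton_mem_lastSpotSet_iff hj).2 (Or.inl ⟨h, rfl⟩)
      · exact (append_singleton_mem_lastSpotSet_iff hj).2 (Or.inr ⟨h, rfl⟩)
  have hdisj : Disjoint
      ((· ++ [j]) '' ({l | MeteredPF (m + 1) n 1 l} \ lastSpotSet (m + 1) n j))
      ((· ++ [j - 1]) '' lastSpotSet (m + 1) n (j - 1)) := by
    rw [Set.disjoint_left]
    rintro _ ⟨l, -, rfl⟩ ⟨l', -, h⟩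
    have := (List.append_inj' h rfl).2
    rw [Finset.mem_Icc] at hj
    simp only [List.cons.injEq, and_true] at this
    omega
  rw [hunion, Set.ncard_union_eq hdisj (hfin.sdiff.image _) ((hfin.subset (hsub _)).image _),
    Set.ncard_image_of_injective _ (List.append_left_injective _),
    Set.ncard_image_of_injective _ (List.append_left_injective _),
    ← Set.ncard_sdiff_add_ncard_of_subset (hsub j) hfin]
  omega

theorem lastSpotSet_one {n j : ℕ} (hj : j ∈ Finset.Icc 1 n) : lastSpotSet 1 n j = {[j]} := by
  have hout (a : ℕ) (ha : a ≤ n) : parkOutcome n 1 [a] = [some a] := by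
    obtain ⟨k, rfl⟩ := Nat.exists_eq_add_of_le ha
    simp [parkOutcome, parkStep, show a + k + 1 - a = k + 1 by omega, List.range'_succ]
  ext l
  rw [Set.mem_singleton_iff]
  constructor
  · rintro ⟨⟨hlen, hmem, -⟩, h⟩
    obtain ⟨a, rfl⟩ := List.length_eq_one_iff.1 hlen
    rw [hout a (Finset.mem_Icc.1 (hmem a (by simp))).2] at h
    simpa using h
  · rintro rfl
    have := hout j (Finset.mem_Icc.1 hj).2
    refine ⟨⟨rfl, by simpa using hj, by simp [this]⟩, by simp [this]⟩

theorem ncard_lastSpotSet_succ (m : ℕ) {n j : ℕ} (hmj : m + 1 ≤ j) (hjn : j ≤ n) :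
    (lastSpotSet (m + 1) n j).ncard = {l | MeteredPF m n 1 l}.ncard := by
  induction m generalizing j with
  | zero =>
    have hnil : {l | MeteredPF 0 n 1 l} = {[]} := by
      ext l
      exact ⟨fun h => List.length_eq_zero_iff.1 h.1,
        by rintro rfl; simp [MeteredPF, parkOutcome]⟩
    rw [lastSpotSet_one (Finset.mem_Icc.2 ⟨hmj, hjn⟩), hnil, Set.ncard_singleton,
      Set.ncard_singleton]
  | succ m ih =>
    have h := ncard_lastSpotSet_add_two (m := m) (n := n) (j := j)
      (Finset.mem_Icc.2 ⟨by omega, hjn⟩)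
    rw [ih (by omega) hjn, ih (by omega) (by omega)] at h
    exact Nat.add_right_cancel h

/-- If `1 ≤ m ≤ n`, then the number of `1`-metered `(m,n)`-parking
functions in which the last car (car `m`) parks in spot `n` equals the number of
`1`-metered `(m-1,n)`-parking functions: `z_n(m,n) = mpf_{m-1,n}(1)`.  (When `m = 1`
the right-hand side is the number of `0`-car lists, namely `1`, matching the
convention `mpf_{0,n}(1) = 1`.) -/
theorem last_spot_n_count (m n : ℕ) (h1 : 1 ≤ m) (h2 : m ≤ n) :
    Set.ncard {l : List ℕ | MeteredPF m n 1 l ∧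
        (parkOutcome n 1 l).getD (m - 1) none = some n} =
      Set.ncard {l : List ℕ | MeteredPF (m - 1) n 1 l} := by
  obtain ⟨m, rfl⟩ := Nat.exists_eq_add_of_le' h1
  exact ncard_lastSpotSet_succ m h2 le_rfl
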